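/- Let K ≥ 1 and let ε be a real number with 0 < ε < √(3/(4^K − 1)). Then for all real numbers τ_1 < τ_2 < … < τ_K, the family (v_{τ_1}, …, v_{τ_K}) is (ε, ε√(2(4^K − 1)/3))-robustly linearly independent; that is, for every a ∈ ℝ^K with ‖Σ_{i=1}^K a_i v_{τ_i}‖₂ < ε‖a‖₂ there exist indices i and j with a_i ≠ 0, a_j ≠ 0 and ‖a_i v_{τ_i}/‖a_i v_{τ_i}‖₂ + a_j v_{τ_j}/‖a_j v_{τ_j}‖₂‖₂ ≤ ε√(2(4^K − 1)/3). -/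

import Mathlib

/-- The box function: indicator of the interval `[τ, τ + 1]`. -/
noncomputable def boxFn (τ : ℝ) : ℝ → ℝ :=
  Set.indicator (Set.Icc τ (τ + 1)) fun _ => 1

/-- The `L²` norm of a real function on `ℝ` (with respect to Lebesgue measure). -/
noncomputable def L2norm (f : ℝ → ℝ) : ℝ := Real.sqrt (∫ t, f t ^ 2)

open MeasureTheory Finset

theorem boxFn_of_mem {τ t : ℝ} (h : t ∈ Set.Icc τ (τ + 1)) : boxFn τ t = 1 :=
  Set.indicator_of_mem h _

theorem boxFn_of_notMem {τ t : ℝ} (h : t ∉ Set.Icc τ (τ + 1)) : boxFn τ t = 0 :=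
  Set.indicator_of_notMem h _

theorem boxFn_nonneg (τ t : ℝ) : 0 ≤ boxFn τ t :=
  Set.indicator_nonneg (fun _ _ => zero_le_one) t

theorem boxFn_le_one (τ t : ℝ) : boxFn τ t ≤ 1 :=
  Set.indicator_le' (fun _ _ => le_rfl) (fun _ _ => zero_le_one) t

theorem integrable_indicator_Icc_one (x y : ℝ) :
    Integrable ((Set.Icc x y).indicator fun _ => (1 : ℝ)) :=
  (integrable_indicator_iff measurableSet_Icc).2
    (integrableOn_const (by simp [Real.volume_Icc]))

theorem integral_indicator_Icc_one {x y : ℝ} (h : x ≤ y) :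
    ∫ t, (Set.Icc x y).indicator (fun _ => (1 : ℝ)) t = y - x := by
  rw [integral_indicator measurableSet_Icc]
  simp [h]

theorem integrable_boxFn (τ : ℝ) : Integrable (boxFn τ) :=
  integrable_indicator_Icc_one _ _

theorem boxFn_sq (τ t : ℝ) : boxFn τ t ^ 2 = boxFn τ t := by
  by_cases h : t ∈ Set.Icc τ (τ + 1)
  · simp [boxFn_of_mem h]
  · simp [boxFn_of_notMem h]

theorem integrable_boxFn_mul_boxFn (σ τ : ℝ) :
    Integrable fun t => boxFn σ t * boxFn τ t := by
  refine (integrable_boxFn τ).bdd_mul (c := 1) (integrable_boxFn σ).aestronglyMeasurable ?_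
  filter_upwards with t
  rw [Real.norm_of_nonneg (boxFn_nonneg σ t)]
  exact boxFn_le_one σ t

theorem integrable_sum_boxFn_sq {ι : Type*} [Fintype ι] (τ a : ι → ℝ) :
    Integrable fun t => (∑ i, a i * boxFn (τ i) t) ^ 2 := by
  have h : (fun t => (∑ i, a i * boxFn (τ i) t) ^ 2) =
      fun t => ∑ i, ∑ j, a i * a j * (boxFn (τ i) t * boxFn (τ j) t) := by
    funext t
    rw [sq, Finset.sum_mul_sum]
    refine Finset.sum_congr rfl fun i _ => Finset.sum_congr rfl fun j _ => ?_
    ring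
  rw [h]
  exact integrable_finsetSum _ fun i _ => integrable_finsetSum _ fun j _ =>
    (integrable_boxFn_mul_boxFn _ _).const_mul _

theorem L2norm_const_mul_boxFn (a τ : ℝ) : L2norm (fun t => a * boxFn τ t) = |a| := by
  have h : ∫ t, boxFn τ t = 1 := by
    rw [boxFn, integral_indicator_Icc_one (by linarith)]
    ring
  simp only [L2norm, mul_pow, boxFn_sq]
  rw [integral_const_mul, h, mul_one, Real.sqrt_sq_eq_abs]

theorem integral_boxFn_sub_sq_le {σ τ : ℝ} (h : σ ≤ τ) :
    ∫ t, (boxFn σ t - boxFn τ t) ^ 2 ≤ 2 * (τ - σ) := by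
  have key : ∫ t, (boxFn σ t - boxFn τ t) ^ 2 ≤
      ∫ t, ((Set.Icc σ τ).indicator (fun _ => (1 : ℝ)) t +
        (Set.Icc (σ + 1) (τ + 1)).indicator (fun _ => (1 : ℝ)) t) := by
    refine integral_mono_of_nonneg (.of_forall fun t => sq_nonneg _)
      ((integrable_indicator_Icc_one _ _).add (integrable_indicator_Icc_one _ _))
      (.of_forall fun t => ?_)
    simp only [boxFn, Set.indicator_apply, Set.mem_Icc]
    split_ifs <;> first | (norm_num; done) | grind
  rw [integral_add (integrable_indicator_Icc_one _ _) (integrable_indicator_Icc_one _ _),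
    integral_indicator_Icc_one h, integral_indicator_Icc_one (by linarith)] at key
  linarith

/-- Two box functions with coefficients of opposite signs nearly cancel after normalization
if the translates are close. -/
theorem L2norm_normalized_add_le {a b σ τ δ : ℝ} (hab : a * b < 0) (hστ : σ ≤ τ)
    (hδ : τ ≤ σ + δ) :
    L2norm (fun t => (L2norm fun s => a * boxFn σ s)⁻¹ * (a * boxFn σ t) +
      (L2norm fun s => b * boxFn τ s)⁻¹ * (b * boxFn τ t)) ≤ Real.sqrt (2 * δ) := by
  have h : ∀ t, (|a|⁻¹ * (a * boxFn σ t) + |b|⁻¹ * (b * boxFn τ t)) ^ 2 =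
      (boxFn σ t - boxFn τ t) ^ 2 := by
    intro t
    rcases mul_neg_iff.1 hab with ⟨ha, hb⟩ | ⟨ha, hb⟩
    · rw [abs_of_pos ha, abs_of_neg hb, inv_neg, neg_mul, inv_mul_cancel_left₀ ha.ne',
        inv_mul_cancel_left₀ hb.ne]
      ring
    · rw [abs_of_neg ha, abs_of_pos hb, inv_neg, neg_mul, inv_mul_cancel_left₀ ha.ne,
        inv_mul_cancel_left₀ hb.ne']
      ring
  simp only [L2norm_const_mul_boxFn]
  simp only [L2norm, h]
  exact Real.sqrt_le_sqrt ((integral_boxFn_sub_sq_le hστ).trans (by linarith))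

theorem mul_sq_le_integral_sq {f : ℝ → ℝ} (hf : Integrable fun t => f t ^ 2) {x δ c : ℝ}
    (hδ : 0 ≤ δ) (hc : 0 ≤ c) (h : ∀ t ∈ Set.Icc x (x + δ), c ≤ |f t|) :
    δ * c ^ 2 ≤ ∫ t, f t ^ 2 := by
  have key : ∫ t, c ^ 2 * (Set.Icc x (x + δ)).indicator (fun _ => (1 : ℝ)) t ≤
      ∫ t, f t ^ 2 := by
    refine integral_mono ((integrable_indicator_Icc_one _ _).const_mul _) hf fun t => ?_
    by_cases ht : t ∈ Set.Icc x (x + δ)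
    · simp only [Set.indicator_of_mem ht, mul_one]
      rw [← sq_abs (f t)]
      exact pow_le_pow_left₀ hc (h t ht) 2
    · simp only [Set.indicator_of_notMem ht, mul_zero]
      positivity
  rw [integral_const_mul, integral_indicator_Icc_one (by linarith)] at key
  linarith

theorem abs_coeff_le {K : ℕ} {τ a : Fin K → ℝ} {δ : ℝ} (hδ : δ ≤ 1)
    (hsep : ∀ i j, i < j → a i * a j < 0 → τ i + δ < τ j) (k : Fin K) {t : ℝ}
    (ht : t ∈ Set.Icc (τ k) (τ k + δ)) :
    |a k| ≤ |∑ i, a i * boxFn (τ i) t| + ∑ j ∈ Iio k, |a j| := by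
  have hsplit : ∑ i, a i * boxFn (τ i) t =
      ∑ i ∈ Iio k, a i * boxFn (τ i) t + ∑ i ∈ Ici k, a i * boxFn (τ i) t := by
    have hd : Disjoint (Iio k) (Ici k) :=
      Finset.disjoint_left.2 fun i hi hi' => by
        rw [Finset.mem_Iio] at hi
        exact absurd hi (not_lt.2 (Finset.mem_Ici.1 hi'))
    rw [← Finset.sum_union hd]
    refine Finset.sum_congr (Eq.symm (Finset.eq_univ_of_forall fun i => ?_)) fun _ _ => rfl
    rw [Finset.mem_union, Finset.mem_Iio, Finset.mem_Ici]
    exact lt_or_ge i k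
  have hlow : |∑ i ∈ Iio k, a i * boxFn (τ i) t| ≤ ∑ j ∈ Iio k, |a j| := by
    refine (Finset.abs_sum_le_sum_abs _ _).trans (Finset.sum_le_sum fun i _ => ?_)
    rw [abs_mul, abs_of_nonneg (boxFn_nonneg _ _)]
    exact mul_le_of_le_one_right (abs_nonneg _) (boxFn_le_one _ _)
  have hhigh : a k * a k ≤ a k * ∑ i ∈ Ici k, a i * boxFn (τ i) t := by
    rw [Finset.mul_sum]
    have hk : a k * (a k * boxFn (τ k) t) = a k * a k := by
      rw [boxFn_of_mem ⟨ht.1, by linarith [ht.2]⟩, mul_one]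
    rw [← hk]
    refine Finset.single_le_sum (f := fun i => a k * (a i * boxFn (τ i) t)) (fun i hi => ?_)
      (Finset.mem_Ici.2 le_rfl)
    rw [← mul_assoc]
    rcases le_or_gt 0 (a k * a i) with h | h
    · exact mul_nonneg h (boxFn_nonneg _ _)
    · have hki : k < i := by
        refine lt_of_le_of_ne (Finset.mem_Ici.1 hi) fun e => ?_
        subst e
        exact absurd h (not_lt.2 (mul_self_nonneg _))
      have h' := hsep k i hki h
      rw [boxFn_of_notMem fun hm => by linarith [hm.1, ht.2], mul_zero]
  have hhigh' : |a k| ≤ |∑ i ∈ Ici k, a i * boxFn (τ i) t| := by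
    rcases eq_or_ne (a k) 0 with h0 | h0
    · simp [h0]
    · refine le_of_mul_le_mul_left ?_ (abs_pos.2 h0)
      rw [← abs_mul, ← abs_mul, abs_of_nonneg (mul_self_nonneg (a k))]
      exact hhigh.trans (le_abs_self _)
  have hsub := abs_sub (∑ i, a i * boxFn (τ i) t) (∑ i ∈ Iio k, a i * boxFn (τ i) t)
  rw [hsplit, add_sub_cancel_left, ← hsplit] at hsub
  linarith

theorem Fin.sum_Iio_val {K : ℕ} {M : Type*} [AddCommMonoid M] (k : Fin K) (g : ℕ → M) :
    ∑ j ∈ Iio k, g j = ∑ n ∈ range k, g n := by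
  rw [← Nat.Iio_eq_range, ← Fin.map_valEmbedding_Iio, Finset.sum_map]
  rfl

theorem le_two_pow_mul_of_le_add_sum {K : ℕ} {b : Fin K → ℝ} {M : ℝ}
    (h : ∀ k, b k ≤ M + ∑ j ∈ Iio k, b j) (k : Fin K) : b k ≤ 2 ^ (k : ℕ) * M := by
  induction k using WellFoundedLT.induction with
  | ind k ih =>
    have h1 : ∑ j ∈ Iio k, b j ≤ ∑ j ∈ Iio k, 2 ^ (j : ℕ) * M :=
      Finset.sum_le_sum fun j hj => ih j (Finset.mem_Iio.1 hj)
    rw [Fin.sum_Iio_val k fun n => 2 ^ n * M, ← Finset.sum_mul,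
      geom_sum_eq (by norm_num)] at h1
    linarith [h k]

/-- If coefficients of opposite signs belong to `δ`-separated translates, the `L²` norm of a
combination of translated box functions controls its coefficients. -/
theorem mul_sum_sq_le_integral {K : ℕ} {τ a : Fin K → ℝ} {δ : ℝ}
    (hδ0 : 0 < δ) (hδ : δ ≤ 1) (hsep : ∀ i j, i < j → a i * a j < 0 → τ i + δ < τ j) :
    δ * ∑ i, a i ^ 2 ≤ (4 ^ K - 1) / 3 * ∫ t, (∑ i, a i * boxFn (τ i) t) ^ 2 := by
  set I := ∫ t, (∑ i, a i * boxFn (τ i) t) ^ 2 with hI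
  have hI0 : 0 ≤ I := integral_nonneg fun t => sq_nonneg _
  have hstep : ∀ k, |a k| ≤ Real.sqrt (I / δ) + ∑ j ∈ Iio k, |a j| := by
    intro k
    rw [← sub_le_iff_le_add]
    rcases le_or_gt (|a k| - ∑ j ∈ Iio k, |a j|) 0 with hc | hc
    · exact hc.trans (Real.sqrt_nonneg _)
    · refine Real.le_sqrt_of_sq_le ?_
      rw [le_div_iff₀' hδ0]
      refine mul_sq_le_integral_sq (integrable_sum_boxFn_sq τ a) (x := τ k) hδ0.le hc.le ?_
      intro t ht
      linarith [abs_coeff_le hδ hsep k ht]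
  have hbound := le_two_pow_mul_of_le_add_sum hstep
  have hsq : ∀ k : Fin K, a k ^ 2 ≤ 4 ^ (k : ℕ) * (I / δ) := by
    intro k
    have h := pow_le_pow_left₀ (abs_nonneg _) (hbound k) 2
    rwa [sq_abs, mul_pow, Real.sq_sqrt (by positivity), ← pow_mul, mul_comm (k : ℕ) 2, pow_mul,
      show (2 : ℝ) ^ 2 = 4 by norm_num] at h
  have hsum : ∑ k, a k ^ 2 ≤ (4 ^ K - 1) / 3 * (I / δ) := by
    refine (Finset.sum_le_sum fun k _ => hsq k).trans_eq ?_
    rw [← Finset.sum_mul, Fin.sum_univ_eq_sum_range fun n => (4 : ℝ) ^ n,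
      geom_sum_eq (by norm_num)]
    norm_num
  calc δ * ∑ i, a i ^ 2 ≤ δ * ((4 ^ K - 1) / 3 * (I / δ)) := by gcongr
    _ = (4 ^ K - 1) / 3 * I := by field_simp

/-- the dictionary of translated box functions is
`(ε, ε√(2(4^K − 1)/3))`-robustly linearly independent for
`0 < ε < √(3/(4^K − 1))`. -/
theorem stmt8 (K : ℕ) (hK : 1 ≤ K) (ε : ℝ) (hε : 0 < ε)
    (hε' : ε < Real.sqrt (3 / (4 ^ K - 1)))
    (τ : Fin K → ℝ) (hτ : StrictMono τ) :
    ∀ a : Fin K → ℝ,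
      L2norm (fun t => ∑ i, a i * boxFn (τ i) t) < ε * Real.sqrt (∑ i, a i ^ 2) →
      ∃ i j : Fin K, a i ≠ 0 ∧ a j ≠ 0 ∧
        L2norm (fun t =>
            (L2norm fun s => a i * boxFn (τ i) s)⁻¹ * (a i * boxFn (τ i) t)
          + (L2norm fun s => a j * boxFn (τ j) s)⁻¹ * (a j * boxFn (τ j) t))
          ≤ ε * Real.sqrt (2 * (4 ^ K - 1) / 3) := by
  intro a ha
  have hC : 0 < ((4 : ℝ) ^ K - 1) / 3 := by
    have : (1 : ℝ) < 4 ^ K := one_lt_pow₀ (by norm_num) (by omega)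
    linarith
  set C : ℝ := (4 ^ K - 1) / 3 with hCdef
  have hδ0 : 0 < ε ^ 2 * C := by positivity
  have hδ1 : ε ^ 2 * C ≤ 1 := by
    have h := (Real.lt_sqrt hε.le).1 hε'
    rw [show (3 : ℝ) / (4 ^ K - 1) = C⁻¹ by rw [hCdef, inv_div],
      lt_inv_comm₀ (by positivity) hC] at h
    rw [← le_inv_mul_iff₀ (by positivity), mul_one]
    exact h.le
  have hbd : Real.sqrt (2 * (ε ^ 2 * C)) = ε * Real.sqrt (2 * (4 ^ K - 1) / 3) := by
    rw [show 2 * (ε ^ 2 * C) = ε ^ 2 * (2 * (4 ^ K - 1) / 3) by rw [hCdef]; ring,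
      Real.sqrt_mul (sq_nonneg ε), Real.sqrt_sq hε.le]
  by_contra hcon
  have hsep : ∀ i j, i < j → a i * a j < 0 → τ i + ε ^ 2 * C < τ j := by
    intro i j hij hneg
    by_contra! hle
    refine hcon ⟨i, j, left_ne_zero_of_mul hneg.ne, right_ne_zero_of_mul hneg.ne, ?_⟩
    rw [← hbd]
    exact L2norm_normalized_add_le hneg (hτ hij).le hle
  have hmain := mul_sum_sq_le_integral hδ0 hδ1 hsep
  rw [← hCdef] at hmain
  have hle : ε ^ 2 * ∑ i, a i ^ 2 ≤ ∫ t, (∑ i, a i * boxFn (τ i) t) ^ 2 := by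
    refine le_of_mul_le_mul_left ?_ hC
    linarith
  refine absurd ha (not_lt.2 ?_)
  have h := Real.sqrt_le_sqrt hle
  rwa [Real.sqrt_mul (sq_nonneg ε), Real.sqrt_sq hε.le] at h
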